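/- Suppose (I_1,…,I_s) satisfies the RIP and Assumption 3.1 holds. If the minimum value f_min of (P) is attained at a point that is a KKT point of (P), then f_min = f_c, where f_c is the optimal value of the CS-LME reformulation (R). -/

import Mathlib

open MvPolynomial Finset
open scoped Classical

noncomputable section

/-- Union of the earlier blocks `J 0, …, J (i-1)`. -/
def prevUnion {s : ℕ} {α : Type*} (J : Fin s → Finset α) (i : Fin s) : Finset α :=
  (Finset.univ.filter (fun j => j < i)).biUnion J

/-- The arc relation produced by Algorithm 1: `(i, t)` is an arc iff `t < i`,
the intersection of `I i` with the union of the earlier blocks is nonempty and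
contained in `I t`, and `t` is the largest such index. -/
def Arc {n s : ℕ} (I : Fin s → Finset (Fin n)) (i t : Fin s) : Prop :=
  t < i ∧ (I i ∩ prevUnion I i).Nonempty ∧ I i ∩ prevUnion I i ⊆ I t ∧
    ∀ t' : Fin s, t < t' → t' < i → ¬ I i ∩ prevUnion I i ⊆ I t'

/-- The running intersection property. -/
def RIP {n s : ℕ} (I : Fin s → Finset (Fin n)) : Prop :=
  ∀ i : Fin s, 0 < (i : ℕ) → ∃ t : Fin s, t < i ∧ I i ∩ prevUnion I i ⊆ I t

/-- The vector `F_i(x^{(i)}, ν^{(i)})`, written componentwise: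
`F_i = ∇_i f_i − Σ_{t ∈ 𝒜_i} ν^{(i,t)} + Σ_{t ∈ 𝒟_i} ν^{(t,i)}` (here `C_{i,t} = I i ∩ I t`). -/
def Fval {n s : ℕ} (I : Fin s → Finset (Fin n)) (f : Fin s → MvPolynomial (Fin n) ℝ)
    (x : Fin n → ℝ) (ν : Fin s → Fin s → Fin n → ℝ) (i : Fin s) (k : Fin n) : ℝ :=
  eval x (pderiv k (f i))
    - (∑ t, if Arc I i t ∧ k ∈ I i ∩ I t then ν i t k else 0)
    + (∑ t, if Arc I t i ∧ k ∈ I t ∩ I i then ν t i k else 0)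

/-- The correlative sparse Lagrange multiplier expression
`p^{(i)}(x^{(i)}, ν^{(i)}) = L_i(x^{(i)}) F_i(x^{(i)}, ν^{(i)})`, evaluated at `(x, ν)`. -/
def pval {n s : ℕ} (I : Fin s → Finset (Fin n)) (f : Fin s → MvPolynomial (Fin n) ℝ)
    {mh : Fin s → ℕ} (L : ∀ i, Fin (mh i) → Fin n → MvPolynomial (Fin n) ℝ)
    (x : Fin n → ℝ) (ν : Fin s → Fin s → Fin n → ℝ) (i : Fin s) (j : Fin (mh i)) : ℝ :=
  ∑ k ∈ I i, eval x (L i j k) * Fval I f x ν i k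

/-- A quantity can be accumulated along a relation that decreases the index. -/
theorem exists_accumulated {s : ℕ} (R : Fin s → Fin s → Prop) [∀ i t, Decidable (R i t)]
    (hlt : ∀ i t, R i t → t < i)
    (r : Fin s → ℝ) :
    ∃ ν : Fin s → ℝ, ∀ i, ν i = r i + ∑ t, if R t i then ν t else 0 := by
  have wf : WellFounded (fun a b : Fin s => b < a) := wellFounded_gt
  refine ⟨wf.fix (fun i rec => r i + ∑ t, if h : R t i then rec t (hlt t i h) else 0),
    fun i => ?_⟩
  rw [wf.fix_eq]
  simp only [dite_eq_ite]

/-- A supply of total zero on a rooted tree is balanced by a flow along the arcs to the parents;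
vertices outside the tree carry no supply and receive no arcs. -/
theorem exists_tree_flow {s : ℕ} (R : Fin s → Fin s → Prop) [∀ i t, Decidable (R i t)]
    (hlt : ∀ i t, R i t → t < i)
    (r : Fin s → ℝ) (hr : ∑ i, r i = 0) (root : Fin s) (hroot : ∀ t, ¬ R root t)
    (hR : ∀ i, i ≠ root → (∃! t, R i t) ∨ (r i = 0 ∧ ∀ t, ¬ R t i)) :
    ∃ ν : Fin s → ℝ, ∀ i,
      r i - (∑ t, if R i t then ν i else 0) + (∑ t, if R t i then ν t else 0) = 0 := by
  obtain ⟨ν, hν⟩ := exists_accumulated R hlt r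
  have hout : ∀ i, i ≠ root → (∑ t, if R i t then ν i else 0) = ν i := by
    intro i hi
    rcases hR i hi with ⟨t, ht, hu⟩ | ⟨h0, hn⟩
    · rw [Finset.sum_eq_single t (fun b _ hb => if_neg fun h => hb (hu b h)) (by simp),
        if_pos ht]
    · have : ν i = 0 := by rw [hν i, h0]; simp [hn]
      simp [this]
  have hout0 : (∑ t, if R root t then ν root else 0) = 0 := by simp [hroot]
  have hνroot : ν root = 0 := by
    have h1 : ∑ i, ν i = ∑ i, ∑ t, if R i t then ν i else 0 := by
      rw [Finset.sum_comm, Finset.sum_congr rfl fun i _ => hν i, Finset.sum_add_distrib, hr,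
        zero_add]
    have h2 : ∑ i ∈ Finset.univ.erase root, ν i
        = ∑ i ∈ Finset.univ.erase root, ∑ t, if R i t then ν i else 0 :=
      Finset.sum_congr rfl fun i hi => (hout i (Finset.ne_of_mem_erase hi)).symm
    rw [← Finset.add_sum_erase _ _ (Finset.mem_univ root),
      ← Finset.add_sum_erase _ (fun i => ∑ t, if R i t then ν i else 0) (Finset.mem_univ root),
      hout0, h2] at h1
    linarith
  refine ⟨ν, fun i => ?_⟩
  have hi := hν i
  by_cases h : i = root
  · subst h
    linarith
  · linarith [hout i h]

theorem mem_prevUnion {s : ℕ} {α : Type*} {J : Fin s → Finset α} {i : Fin s} {k : α} :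
    k ∈ prevUnion J i ↔ ∃ j < i, k ∈ J j := by
  simp [prevUnion]

theorem Arc.unique {n s : ℕ} {I : Fin s → Finset (Fin n)} {i t t' : Fin s}
    (h : Arc I i t) (h' : Arc I i t') : t = t' := by
  rcases lt_trichotomy t t' with hlt | heq | hlt
  · exact absurd h'.2.2.1 (h.2.2.2 t' hlt h'.1)
  · exact heq
  · exact absurd h.2.2.1 (h'.2.2.2 t hlt h.1)

theorem RIP.exists_arc {n s : ℕ} {I : Fin s → Finset (Fin n)} (hrip : RIP I) {i : Fin s}
    (hi : (I i ∩ prevUnion I i).Nonempty) : ∃ t, Arc I i t := by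
  obtain ⟨k, hk⟩ := hi
  obtain ⟨j, hj, -⟩ := mem_prevUnion.1 (Finset.mem_inter.1 hk).2
  obtain ⟨t₀, ht₀⟩ := hrip i (lt_of_le_of_lt (Nat.zero_le _) hj)
  obtain ⟨t, ht, hmax⟩ := (Finset.univ.filter
    fun t => t < i ∧ I i ∩ prevUnion I i ⊆ I t).exists_max_image id ⟨t₀, by simpa using ht₀⟩
  simp only [Finset.mem_filter, Finset.mem_univ, true_and, id] at ht hmax
  exact ⟨t, ht.1, ⟨k, hk⟩, ht.2, fun t' htt' ht'i hsub =>
    absurd (hmax t' ⟨ht'i, hsub⟩) (not_le.2 htt')⟩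

/-- Under the RIP, any residuals that sum to zero at an index `k` and vanish on the blocks not
containing `k` are balanced along the arcs whose separators contain `k`. -/
theorem RIP.exists_flow {n s : ℕ} {I : Fin s → Finset (Fin n)} (hrip : RIP I) {k : Fin n}
    (hk : ∃ i, k ∈ I i) (r : Fin s → ℝ) (hr : ∑ i, r i = 0) (hr0 : ∀ i, k ∉ I i → r i = 0) :
    ∃ ν : Fin s → ℝ, ∀ i, r i - (∑ t, if Arc I i t ∧ k ∈ I i ∩ I t then ν i else 0)
      + (∑ t, if Arc I t i ∧ k ∈ I t ∩ I i then ν t else 0) = 0 := by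
  obtain ⟨i₀, hi₀⟩ := hk
  obtain ⟨root, hroot, hmin⟩ := (Finset.univ.filter fun i => k ∈ I i).exists_min_image id
    ⟨i₀, by simpa using hi₀⟩
  simp only [Finset.mem_filter, Finset.mem_univ, true_and, id] at hroot hmin
  refine exists_tree_flow (fun i t => Arc I i t ∧ k ∈ I i ∩ I t) (fun i t h => h.1.1) r hr root
    (fun t h => absurd (hmin t (Finset.mem_inter.1 h.2).2) (not_le.2 h.1.1)) fun i hi => ?_
  by_cases hki : k ∈ I i
  · left
    have hmem : k ∈ I i ∩ prevUnion I i := Finset.mem_inter.2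
      ⟨hki, mem_prevUnion.2 ⟨root, lt_of_le_of_ne (hmin i hki) (Ne.symm hi), hroot⟩⟩
    obtain ⟨t, ht⟩ := hrip.exists_arc ⟨k, hmem⟩
    exact ⟨t, ⟨ht, Finset.mem_inter.2 ⟨hki, ht.2.2.1 hmem⟩⟩, fun t' ht' => ht'.1.unique ht⟩
  · exact Or.inr ⟨hr0 i hki, fun t h => hki (Finset.mem_inter.1 h.2).2⟩

/-- The Lagrange multiplier expression recovers every complementary multiplier. -/
theorem pval_eq_of_Fval_eq {n s : ℕ} {I : Fin s → Finset (Fin n)}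
    {f : Fin s → MvPolynomial (Fin n) ℝ} {mh : Fin s → ℕ}
    {c : ∀ i, Fin (mh i) → MvPolynomial (Fin n) ℝ}
    {L : ∀ i, Fin (mh i) → Fin n → MvPolynomial (Fin n) ℝ}
    {D : ∀ i, Fin (mh i) → Fin (mh i) → MvPolynomial (Fin n) ℝ} {i : Fin s}
    (hLD : ∀ j j' : Fin (mh i),
      (∑ k ∈ I i, L i j k * pderiv k (c i j')) + D i j j' * c i j' = if j = j' then 1 else 0)
    {x : Fin n → ℝ} {ν : Fin s → Fin s → Fin n → ℝ} {lam : Fin (mh i) → ℝ}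
    (hF : ∀ k ∈ I i, Fval I f x ν i k = ∑ j, lam j * eval x (pderiv k (c i j)))
    (hcomp : ∀ j, lam j * eval x (c i j) = 0) (j : Fin (mh i)) :
    pval I f L x ν i j = lam j := by
  have hcol : ∀ j', lam j' * ∑ k ∈ I i, eval x (L i j k) * eval x (pderiv k (c i j'))
      = if j = j' then lam j' else 0 := by
    intro j'
    have h := congrArg (eval x) (hLD j j')
    simp only [map_add, map_sum, map_mul, apply_ite (eval x), map_one, map_zero] at h
    rw [eq_sub_of_add_eq h]
    split_ifs <;> linear_combination (-eval x (D i j j')) * hcomp j'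
  calc pval I f L x ν i j
      = ∑ k ∈ I i, ∑ j', lam j' * (eval x (L i j k) * eval x (pderiv k (c i j'))) := by
        refine Finset.sum_congr rfl fun k hk => ?_
        rw [hF k hk, Finset.mul_sum]
        exact Finset.sum_congr rfl fun j' _ => by ring
    _ = ∑ j', lam j' * ∑ k ∈ I i, eval x (L i j k) * eval x (pderiv k (c i j')) := by
        rw [Finset.sum_comm]
        simp only [Finset.mul_sum]
    _ = lam j := by simp [hcol]

/-- Theorem 3.2: under the RIP and Assumption 3.1, if the minimum
value `f_min` of (P) is attained at a point `xstar` that is a KKT point, then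
`f_min = f_c`, the optimal value of the CS-LME reformulation (R). -/
theorem cs_lme_reformulation_value
    (n s : ℕ) (I : Fin s → Finset (Fin n))
    (hcover : ∀ k : Fin n, ∃ i, k ∈ I i) (hrip : RIP I)
    (m ℓ : Fin s → ℕ)
    (f : Fin s → MvPolynomial (Fin n) ℝ)
    (c : ∀ i, Fin (m i + ℓ i) → MvPolynomial (Fin n) ℝ)
    (hf : ∀ i, (f i).vars ⊆ I i) (hc : ∀ i j, (c i j).vars ⊆ I i)
    -- Assumption 3.1
    (L : ∀ i, Fin (m i + ℓ i) → Fin n → MvPolynomial (Fin n) ℝ)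
    (D : ∀ i, Fin (m i + ℓ i) → Fin (m i + ℓ i) → MvPolynomial (Fin n) ℝ)
    (hL : ∀ i j k, (L i j k).vars ⊆ I i) (hD : ∀ i j j', (D i j j').vars ⊆ I i)
    (hLD : ∀ i (j j' : Fin (m i + ℓ i)),
      (∑ k ∈ I i, L i j k * pderiv k (c i j')) + D i j j' * c i j'
        = if j = j' then 1 else 0)
    -- xstar is a minimizer of (P) (so f_min = f(xstar)) ...
    (xstar : Fin n → ℝ)
    (hfeas : ∀ i, (∀ j : Fin (ℓ i), eval xstar (c i (Fin.natAdd (m i) j)) = 0) ∧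
      (∀ j : Fin (m i), 0 ≤ eval xstar (c i (Fin.castAdd (ℓ i) j))))
    (hopt : ∀ x : Fin n → ℝ,
      (∀ i, (∀ j : Fin (ℓ i), eval x (c i (Fin.natAdd (m i) j)) = 0) ∧
        (∀ j : Fin (m i), 0 ≤ eval x (c i (Fin.castAdd (ℓ i) j)))) →
      (∑ i, eval xstar (f i)) ≤ ∑ i, eval x (f i))
    -- ... and xstar is a KKT point of (P)
    (hkkt : ∃ lam : ∀ i, Fin (m i + ℓ i) → ℝ,
      (∀ k : Fin n, (∑ i, eval xstar (pderiv k (f i))) =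
          ∑ i, ∑ j, lam i j * eval xstar (pderiv k (c i j))) ∧
      (∀ i, (∀ j : Fin (ℓ i), eval xstar (c i (Fin.natAdd (m i) j)) = 0) ∧
        (∀ j : Fin (m i), 0 ≤ lam i (Fin.castAdd (ℓ i) j)
          ∧ 0 ≤ eval xstar (c i (Fin.castAdd (ℓ i) j))
          ∧ lam i (Fin.castAdd (ℓ i) j) * eval xstar (c i (Fin.castAdd (ℓ i) j)) = 0))) :
    -- f_c = f_min : the optimal value of the CS-LME reformulation (R) equals f(xstar)
    sInf {y : ℝ | ∃ (x : Fin n → ℝ) (ν : Fin s → Fin s → Fin n → ℝ),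
        (∀ i : Fin s,
          (∀ k ∈ I i,
            Fval I f x ν i k = ∑ j, pval I f L x ν i j * eval x (pderiv k (c i j))) ∧
          (∀ j : Fin (ℓ i), eval x (c i (Fin.natAdd (m i) j)) = 0) ∧
          (∀ j : Fin (m i), 0 ≤ pval I f L x ν i (Fin.castAdd (ℓ i) j)
            ∧ 0 ≤ eval x (c i (Fin.castAdd (ℓ i) j))
            ∧ pval I f L x ν i (Fin.castAdd (ℓ i) j)
                * eval x (c i (Fin.castAdd (ℓ i) j)) = 0)) ∧
        (∑ i, eval x (f i)) = y}
      = ∑ i, eval xstar (f i) := by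
  obtain ⟨lam, hstat, hlam⟩ := hkkt
  have hcomp : ∀ i j, lam i j * eval xstar (c i j) = 0 := by
    intro i j
    induction j using Fin.addCases with
    | left j => exact ((hlam i).2 j).2.2
    | right j => rw [(hlam i).1 j, mul_zero]
  have hflow : ∀ k, ∃ ν : Fin s → ℝ, ∀ i,
      (eval xstar (pderiv k (f i)) - ∑ j, lam i j * eval xstar (pderiv k (c i j)))
        - (∑ t, if Arc I i t ∧ k ∈ I i ∩ I t then ν i else 0)
        + (∑ t, if Arc I t i ∧ k ∈ I t ∩ I i then ν t else 0) = 0 := by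
    intro k
    refine hrip.exists_flow (hcover k) _ ?_ fun i hki => ?_
    · rw [Finset.sum_sub_distrib, hstat k, sub_self]
    · rw [pderiv_eq_zero_of_notMem_vars fun h => hki (hf i h)]
      simp [fun j => pderiv_eq_zero_of_notMem_vars fun h => hki (hc i j h)]
  choose ν hν using hflow
  have hF : ∀ i k, Fval I f xstar (fun i _ k => ν k i) i k
      = ∑ j, lam i j * eval xstar (pderiv k (c i j)) := by
    intro i k
    have := hν k i
    unfold Fval
    linarith
  have hp : ∀ i j, pval I f L xstar (fun i _ k => ν k i) i j = lam i j := fun i =>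
    pval_eq_of_Fval_eq (mh := fun i => m i + ℓ i) (c := c) (hLD i) (fun k _ => hF i k) (hcomp i)
  refine IsLeast.csInf_eq ⟨⟨xstar, fun i _ k => ν k i, fun i => ⟨fun k _ => ?_, (hlam i).1,
    fun j => ?_⟩, rfl⟩, ?_⟩
  · simp only [hF, hp]
  · rw [hp]
    exact (hlam i).2 j
  · rintro y ⟨x, ν', hx, rfl⟩
    exact hopt x fun i => ⟨(hx i).2.1, fun j => ((hx i).2.2 j).2.1⟩
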